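/- arXiv:2209.10028 — 2 statements merged into one kernel-verified Lean document; each statement's English description precedes it below -/
import Mathlib

section
/- Every quasi-metric space on four points defined by a directed graph (i.e., d(x,y) is the length of a shortest directed path in a strongly connected digraph on the four vertices) has the de Bruijn–Erdős property: it has a universal line or at least four distinct lines. -/
/-- A quasi-metric on `V`: nonnegative, vanishing exactly on the diagonal,
and satisfying the (directed) triangle inequality. -/
def IsQuasiMetric {V : Type*} (d : V → V → ℝ) : Prop :=
  (∀ x y, 0 ≤ d x y) ∧ (∀ x y, d x y = 0 ↔ x = y) ∧ (∀ x y z, d x z ≤ d x y + d y z)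

/-- Betweenness: `y` lies between `x` and `z` (all three pairwise distinct). -/
def BtwQM {V : Type*} (d : V → V → ℝ) (x y z : V) : Prop :=
  x ≠ y ∧ y ≠ z ∧ x ≠ z ∧ d x z = d x y + d y z

/-- The line through `x` and `y`. -/
def lineQM {V : Type*} (d : V → V → ℝ) (x y : V) : Set V :=
  {z | d z y = d z x + d x y ∨ d x y = d x z + d z y ∨ d x z = d x y + d y z}

/-- The set of all lines of the space. -/
def linesQM {V : Type*} (d : V → V → ℝ) : Set (Set V) :=
  {ℓ | ∃ x y, x ≠ y ∧ ℓ = lineQM d x y}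

/-- A directed walk of length `n` from `x` to `y` in the digraph with arc relation `A`. -/
def HasWalk {W : Type*} (A : W → W → Prop) (x y : W) (n : ℕ) : Prop :=
  ∃ f : Fin (n + 1) → W, f 0 = x ∧ f (Fin.last n) = y ∧
    ∀ i : Fin n, A (f i.castSucc) (f i.succ)

/-- The distance in a digraph: the length of a shortest directed walk. -/
noncomputable def digraphDist {W : Type*} (A : W → W → Prop) (x y : W) : ℝ :=
  (sInf {n : ℕ | HasWalk A x y n} : ℕ)

/-- Adjacency in the loopless digraph on `{0, 1, 2, 3}` whose arcs are listed by the
twelve low bits of `m`, in lexicographic order. Raw operations on `Nat` are used here and below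
because the kernel evaluates them quickly. -/
def arcBit (m x y : ℕ) : Bool :=
  Nat.testBit m (Nat.sub (Nat.add (Nat.mul 4 x) y)
    (Nat.succ (Nat.div (Nat.add (Nat.mul 4 x) y) 5)))

/-- The distance in a digraph on `{0, 1, 2, 3}`, with value `3` when there is no walk of length
at most two. -/
def truncDist (a : ℕ → ℕ → Bool) (x y : ℕ) : ℕ :=
  bif x.beq y then 0 else
  bif a x y then 1 else
  bif (List.range 4).any fun z => !(z.beq x) && !(z.beq y) && (a x z && a z y) then 2 else 3

/-- Whether `z` is on the line through `x` and `y`, as a Boolean. -/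
def inLine (f : ℕ → ℕ → ℕ) (x y z : ℕ) : Bool :=
  or (Nat.beq (f z y) (Nat.add (f z x) (f x y)))
    (or (Nat.beq (f x y) (Nat.add (f x z) (f z y))) (Nat.beq (f x z) (Nat.add (f x y) (f y z))))

/-- The line through `x` and `y`, coded in binary. -/
def lineCode (f : ℕ → ℕ → ℕ) (x y : ℕ) : ℕ :=
  (inLine f x y 0).toNat + 2 * (inLine f x y 1).toNat + 4 * (inLine f x y 2).toNat +
    8 * (inLine f x y 3).toNat

/-- The codes of all lines. -/
def lineCodes (f : ℕ → ℕ → ℕ) : List ℕ :=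
  [lineCode f 0 1, lineCode f 0 2, lineCode f 0 3, lineCode f 1 0, lineCode f 1 2, lineCode f 1 3,
    lineCode f 2 0, lineCode f 2 1, lineCode f 2 3, lineCode f 3 0, lineCode f 3 1, lineCode f 3 2]

theorem lineCodes_truncDist : ∀ i < 64, ∀ j < 64,
    15 ∈ lineCodes (truncDist (arcBit (64 * i + j))) ∨
      4 ≤ (lineCodes (truncDist (arcBit (64 * i + j)))).dedup.length := by
  decide +kernel

theorem exists_arcBit_eq (B : Fin 4 → Fin 4 → Bool) :
    ∃ i < 64, ∃ j < 64, ∀ x y : Fin 4, x ≠ y → arcBit (64 * i + j) x y = B x y := by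
  let tail (k : ℕ) : Fin 4 := Fin.ofNat 4 (k / 3)
  let head (k : ℕ) : Fin 4 := (tail k).succAbove (Fin.ofNat 3 k)
  let b (k : Fin 12) : Bool := B (tail k) (head k)
  have hb : Nat.ofBits b < 4096 := Nat.ofBits_lt_two_pow b
  have hidx : ∀ x y : Fin 4, x ≠ y →
      let k := Nat.sub (Nat.add (Nat.mul 4 x) y) (Nat.succ (Nat.div (Nat.add (Nat.mul 4 x) y) 5))
      k < 12 ∧ tail k = x ∧ head k = y := by
    decide
  refine ⟨Nat.ofBits b / 64, by omega, Nat.ofBits b % 64, by omega, fun x y hxy => ?_⟩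
  obtain ⟨hk, hx, hy⟩ := hidx x y hxy
  rw [Nat.div_add_mod]
  refine (Nat.testBit_ofBits_lt b _ hk).trans ?_
  simp only [b, hx, hy]

theorem truncDist_eq {a : ℕ → ℕ → Bool} {B : Fin 4 → Fin 4 → Bool}
    (h : ∀ x y : Fin 4, x ≠ y → a x y = B x y) (x y : Fin 4) :
    truncDist a x y = if x = y then 0 else if B x y then 1 else
      if ∃ z, z ≠ x ∧ z ≠ y ∧ B x z ∧ B z y then 2 else 3 := by
  by_cases hxy : x = y
  · simp [truncDist, hxy]
  have hbeq (u v : Fin 4) (huv : u ≠ v) : (u : ℕ).beq v = false :=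
    Bool.eq_false_iff.2 fun h => huv (Fin.ext (Nat.eq_of_beq_eq_true h))
  have hany : ((List.range 4).any fun z => !(z.beq x) && !(z.beq y) && (a x z && a z y)) = true ↔
      ∃ z, z ≠ x ∧ z ≠ y ∧ B x z ∧ B z y := by
    simp only [List.any_eq_true, List.mem_range, Bool.and_eq_true, Bool.not_eq_true', and_assoc]
    constructor
    · rintro ⟨z, hz, hzx, hzy, h1, h2⟩
      have hx : (⟨z, hz⟩ : Fin 4) ≠ x := by rintro rfl; simp at hzx
      have hy : (⟨z, hz⟩ : Fin 4) ≠ y := by rintro rfl; simp at hzy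
      exact ⟨⟨z, hz⟩, hx, hy, by rw [← h _ _ hx.symm]; exact h1, by rw [← h _ _ hy]; exact h2⟩
    · rintro ⟨z, hx, hy, h1, h2⟩
      exact ⟨z, z.2, hbeq _ _ hx, hbeq _ _ hy, by rwa [h _ _ hx.symm], by rwa [h _ _ hy]⟩
  simp only [truncDist, hbeq x y hxy, h x y hxy, hxy, if_false, Bool.cond_eq_ite, hany,
    Bool.false_eq_true]

theorem exists_of_mem_lineCodes {f : ℕ → ℕ → ℕ} {c : ℕ} (h : c ∈ lineCodes f) :
    ∃ x y : Fin 4, x ≠ y ∧ lineCode f x y = c := by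
  simp only [lineCodes, List.mem_cons, List.not_mem_nil, or_false] at h
  rcases h with h | h | h | h | h | h | h | h | h | h | h | h
  exacts [⟨0, 1, by decide, h.symm⟩, ⟨0, 2, by decide, h.symm⟩, ⟨0, 3, by decide, h.symm⟩,
    ⟨1, 0, by decide, h.symm⟩, ⟨1, 2, by decide, h.symm⟩, ⟨1, 3, by decide, h.symm⟩,
    ⟨2, 0, by decide, h.symm⟩, ⟨2, 1, by decide, h.symm⟩, ⟨2, 3, by decide, h.symm⟩,
    ⟨3, 0, by decide, h.symm⟩, ⟨3, 1, by decide, h.symm⟩, ⟨3, 2, by decide, h.symm⟩]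

theorem inLine_of_lineCode_eq {f : ℕ → ℕ → ℕ} {x y : ℕ} (h : lineCode f x y = 15) (z : Fin 4) :
    inLine f x y z = true := by
  have h0 := Bool.toNat_le (inLine f x y 0)
  have h1 := Bool.toNat_le (inLine f x y 1)
  have h2 := Bool.toNat_le (inLine f x y 2)
  have h3 := Bool.toNat_le (inLine f x y 3)
  unfold lineCode at h
  have key : inLine f x y 0 = true ∧ inLine f x y 1 = true ∧ inLine f x y 2 = true ∧
      inLine f x y 3 = true := by
    simp only [← Bool.toNat_eq_one]
    omega
  fin_cases z
  exacts [key.1, key.2.1, key.2.2.1, key.2.2.2]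

theorem mem_lineQM_iff_inLine {W : Type*} {d : W → W → ℝ} {e : W ≃ Fin 4} {f : ℕ → ℕ → ℕ}
    (h : ∀ x y, d x y = f (e x) (e y)) (x y z : W) :
    z ∈ lineQM d x y ↔ inLine f (e x) (e y) (e z) = true := by
  simp only [lineQM, Set.mem_ofPred_eq, h, inLine, Bool.or_eq_true, Nat.beq_eq, Nat.add_eq]
  norm_cast

/-- Four points whose distances are `f` have the de Bruijn–Erdős property if the codes of the
lines of `f` witness it. -/
theorem universal_or_four_le_of_lineCodes {W : Type*} {d : W → W → ℝ} (e : W ≃ Fin 4)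
    {f : ℕ → ℕ → ℕ} (h : ∀ x y, d x y = f (e x) (e y))
    (hf : 15 ∈ lineCodes f ∨ 4 ≤ (lineCodes f).dedup.length) :
    (∃ x y : W, x ≠ y ∧ lineQM d x y = Set.univ) ∨ 4 ≤ (linesQM d).ncard := by
  classical
  have : Finite W := Finite.of_equiv _ e.symm
  refine hf.imp (fun h15 => ?_) fun h4 => ?_
  · obtain ⟨x, y, hxy, hc⟩ := exists_of_mem_lineCodes h15
    refine ⟨e.symm x, e.symm y, by simpa using hxy, Set.eq_univ_of_forall fun z => ?_⟩
    rw [mem_lineQM_iff_inLine h, e.apply_symm_apply, e.apply_symm_apply]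
    exact inLine_of_lineCode_eq hc _
  · let bit (s : Set W) (z : Fin 4) : ℕ := (decide (e.symm z ∈ s)).toNat
    let code (s : Set W) : ℕ := bit s 0 + 2 * bit s 1 + 4 * bit s 2 + 8 * bit s 3
    have hbit (x y z : Fin 4) :
        bit (lineQM d (e.symm x) (e.symm y)) z = (inLine f x y z).toNat := by
      simp [bit, mem_lineQM_iff_inLine h]
    have hcode (x y : Fin 4) : code (lineQM d (e.symm x) (e.symm y)) = lineCode f x y := by
      simp only [code, hbit]
      rfl
    have hsub : ((lineCodes f).toFinset : Set ℕ) ⊆ code '' linesQM d := by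
      intro c hc
      obtain ⟨x, y, hxy, rfl⟩ := exists_of_mem_lineCodes (List.mem_toFinset.1 hc)
      exact ⟨_, ⟨e.symm x, e.symm y, by simpa using hxy, rfl⟩, hcode x y⟩
    calc 4 ≤ (lineCodes f).toFinset.card := by rwa [List.card_toFinset]
      _ = ((lineCodes f).toFinset : Set ℕ).ncard := (Set.ncard_coe_finset _).symm
      _ ≤ (code '' linesQM d).ncard := Set.ncard_le_ncard hsub (Set.toFinite _)
      _ ≤ (linesQM d).ncard := Set.ncard_image_le (Set.toFinite _)

section Walks

variable {W : Type*} {A : W → W → Prop}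

theorem hasWalk_zero_iff {x y : W} : HasWalk A x y 0 ↔ x = y := by
  constructor
  · rintro ⟨f, h0, h1, -⟩
    exact h0.symm.trans h1
  · rintro rfl
    exact ⟨fun _ => x, rfl, rfl, fun i => i.elim0⟩

theorem hasWalk_succ_iff {x y : W} {n : ℕ} :
    HasWalk A x y (n + 1) ↔ ∃ z, A x z ∧ HasWalk A z y n := by
  constructor
  · rintro ⟨f, rfl, rfl, h⟩
    exact ⟨f 1, h 0, fun i => f i.succ, rfl, rfl, fun i => h i.succ⟩
  · rintro ⟨z, hxz, f, rfl, rfl, h⟩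
    refine ⟨Fin.cons x f, rfl, rfl, fun i => ?_⟩
    refine Fin.cases hxz (fun i => ?_) i
    exact h i

/-- The digraph distance as a natural number. -/
noncomputable def digraphNatDist (A : W → W → Prop) (x y : W) : ℕ :=
  sInf {n : ℕ | HasWalk A x y n}

theorem digraphNatDist_le {x y : W} {n : ℕ} (h : HasWalk A x y n) : digraphNatDist A x y ≤ n :=
  Nat.sInf_le h

theorem hasWalk_digraphNatDist (hconn : ∀ x y : W, ∃ n : ℕ, HasWalk A x y n) (x y : W) :
    HasWalk A x y (digraphNatDist A x y) :=
  Nat.sInf_mem (hconn x y)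

theorem digraphNatDist_eq_zero_iff (hconn : ∀ x y : W, ∃ n : ℕ, HasWalk A x y n) {x y : W} :
    digraphNatDist A x y = 0 ↔ x = y := by
  refine ⟨fun h => ?_, fun h => Nat.le_zero.1 (digraphNatDist_le (hasWalk_zero_iff.2 h))⟩
  rw [← hasWalk_zero_iff (A := A), ← h]
  exact hasWalk_digraphNatDist hconn x y

theorem exists_adj_digraphNatDist (hconn : ∀ x y : W, ∃ n : ℕ, HasWalk A x y n) {x y : W} {n : ℕ}
    (h : digraphNatDist A x y = n + 1) : ∃ z, A x z ∧ digraphNatDist A z y = n := by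
  have hw := hasWalk_digraphNatDist hconn x y
  rw [h, hasWalk_succ_iff] at hw
  obtain ⟨z, hxz, hz⟩ := hw
  have h1 := digraphNatDist_le hz
  have h2 := digraphNatDist_le (hasWalk_succ_iff.2 ⟨z, hxz, hasWalk_digraphNatDist hconn z y⟩)
  exact ⟨z, hxz, by omega⟩

theorem exists_digraphNatDist_eq (hconn : ∀ x y : W, ∃ n : ℕ, HasWalk A x y n) {y : W} {k : ℕ}
    (x : W) (hk : k ≤ digraphNatDist A x y) : ∃ z, digraphNatDist A z y = k := by
  obtain ⟨n, hn⟩ := Nat.exists_eq_add_of_le hk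
  induction n generalizing x with
  | zero => exact ⟨x, hn⟩
  | succ n ih =>
    obtain ⟨z, -, hz⟩ := exists_adj_digraphNatDist hconn (n := k + n) hn
    exact ih z (by omega) hz

theorem digraphNatDist_lt_card [Fintype W] (hconn : ∀ x y : W, ∃ n : ℕ, HasWalk A x y n)
    (x y : W) : digraphNatDist A x y < Fintype.card W := by
  classical
  have hsub : Finset.range (digraphNatDist A x y + 1) ⊆
      Finset.univ.image fun z => digraphNatDist A z y := by
    intro k hk
    obtain ⟨z, hz⟩ := exists_digraphNatDist_eq hconn x (Nat.lt_succ_iff.1 (Finset.mem_range.1 hk))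
    exact Finset.mem_image.2 ⟨z, Finset.mem_univ z, hz⟩
  simpa using (Finset.card_le_card hsub).trans Finset.card_image_le

theorem hasWalk_one_iff {x y : W} : HasWalk A x y 1 ↔ A x y := by
  simp [hasWalk_succ_iff, hasWalk_zero_iff]

theorem hasWalk_two_iff {x y : W} : HasWalk A x y 2 ↔ ∃ z, A x z ∧ A z y := by
  simp [hasWalk_succ_iff (n := 1), hasWalk_one_iff]

open Classical in
theorem digraphNatDist_eq_ite [Fintype W] (hW : Fintype.card W = 4)
    (hconn : ∀ x y : W, ∃ n : ℕ, HasWalk A x y n) (x y : W) :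
    digraphNatDist A x y = if x = y then 0 else if A x y then 1 else
      if ∃ z, z ≠ x ∧ z ≠ y ∧ A x z ∧ A z y then 2 else 3 := by
  have hlt := hW ▸ digraphNatDist_lt_card hconn x y
  have hw := hasWalk_digraphNatDist hconn x y
  have h0 := digraphNatDist_eq_zero_iff hconn (x := x) (y := y)
  split_ifs with hxy hA hz
  · exact h0.2 hxy
  · have := digraphNatDist_le (hasWalk_one_iff.2 hA)
    have := mt h0.1 hxy
    omega
  · obtain ⟨z, -, -, hz⟩ := hz
    have := digraphNatDist_le (hasWalk_two_iff.2 ⟨z, hz⟩)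
    have := mt h0.1 hxy
    have : digraphNatDist A x y ≠ 1 := fun h => hA (hasWalk_one_iff.1 (h ▸ hw))
    omega
  · have := mt h0.1 hxy
    have : digraphNatDist A x y ≠ 1 := fun h => hA (hasWalk_one_iff.1 (h ▸ hw))
    have : digraphNatDist A x y ≠ 2 := by
      intro h
      obtain ⟨z, hxz, hzy⟩ := hasWalk_two_iff.1 (h ▸ hw)
      exact hz ⟨z, by rintro rfl; exact hA hzy, by rintro rfl; exact hA hxz, hxz, hzy⟩
    omega

end Walks

/-- every quasi-metric space on four points defined by a strongly
connected directed graph has the de Bruijn–Erdős property. -/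
theorem stmt_10 (W : Type) [Fintype W] (hW : Fintype.card W = 4)
    (A : W → W → Prop) (hconn : ∀ x y : W, ∃ n : ℕ, HasWalk A x y n) :
    (∃ x y : W, x ≠ y ∧ lineQM (digraphDist A) x y = Set.univ) ∨
      4 ≤ (linesQM (digraphDist A)).ncard := by
  classical
  let e := Fintype.equivFinOfCardEq hW
  obtain ⟨i, hi, j, hj, hB⟩ := exists_arcBit_eq fun x y => decide (A (e.symm x) (e.symm y))
  refine universal_or_four_le_of_lineCodes e (fun x y => ?_) (lineCodes_truncDist i hi j hj)
  rw [truncDist_eq hB]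
  change ((digraphNatDist A x y : ℕ) : ℝ) = _
  rw [digraphNatDist_eq_ite hW hconn]
  simp [e.surjective.exists]
end

section
/- Let (V, d) be a quasi-metric space on a three-element set V = {a, b, c}. Then the betweenness B(d) is isomorphic (via a bijection of V) to exactly one of the following five sets of triples on {a,b,c}: ∅, {(a,b,c)}, {(a,b,c),(c,b,a)}, {(a,b,c),(b,c,a)}, and {(a,b,c),(b,c,a),(c,a,b)}. -/
/-- The five candidate betweennesses on a three-element set `{a, b, c}`. -/
def trip3 {V : Type*} (a b c : V) : Fin 5 → Set (V × V × V)
  | 0 => ∅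
  | 1 => {(a, b, c)}
  | 2 => {(a, b, c), (c, b, a)}
  | 3 => {(a, b, c), (b, c, a)}
  | 4 => {(a, b, c), (b, c, a), (c, a, b)}

theorem mem_trip3_map_iff {V : Type*} (f : V ≃ V) (p q r x y z : V) (i : Fin 5) :
    (f x, f y, f z) ∈ trip3 (f p) (f q) (f r) i ↔ (x, y, z) ∈ trip3 p q r i := by
  fin_cases i <;> simp [trip3]

theorem IsQuasiMetric.pos {V : Type*} {d : V → V → ℝ} (hd : IsQuasiMetric d) {x y : V}
    (h : x ≠ y) : 0 < d x y :=
  (hd.1 x y).lt_of_ne fun h0 => h ((hd.2.1 x y).1 h0.symm)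

theorem BtwQM.not_swap_right {V : Type*} {d : V → V → ℝ} (hd : IsQuasiMetric d) {x y z : V}
    (h : BtwQM d x y z) : ¬ BtwQM d x z y := fun h' => by
  linarith [h.2.2.2, h'.2.2.2, hd.pos h.2.1, hd.pos h.2.1.symm]

theorem BtwQM.not_swap_left {V : Type*} {d : V → V → ℝ} (hd : IsQuasiMetric d) {x y z : V}
    (h : BtwQM d x y z) : ¬ BtwQM d y x z := fun h' => by
  linarith [h.2.2.2, h'.2.2.2, hd.pos h.1, hd.pos h.1.symm]

/-- A relation on triples of distinct points of a three-element set that never holds together with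
an adjacent transposition is one of the five sets `trip3`, up to relabelling. -/
theorem exists_eq_trip3 {V : Type*} {B : V → V → V → Prop} {a b c : V}
    (hab : a ≠ b) (hbc : b ≠ c) (hac : a ≠ c) (hV : ∀ x : V, x = a ∨ x = b ∨ x = c)
    (hB : ∀ x y z, B x y z → x ≠ y ∧ y ≠ z ∧ x ≠ z)
    (hr : ∀ x y z, B x y z → ¬ B x z y) (hl : ∀ x y z, B x y z → ¬ B y x z) :
    ∃ (i : Fin 5) (p q r : V), p ≠ q ∧ q ≠ r ∧ p ≠ r ∧
      ∀ x y z, B x y z ↔ (x, y, z) ∈ trip3 p q r i := by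
  have key : ∀ p q r, B p q r → ∀ x y z, B x y z →
      (x = p ∧ y = q ∧ z = r) ∨ (x = q ∧ y = r ∧ z = p) ∨ (x = r ∧ y = p ∧ z = q) ∨
        (x = r ∧ y = q ∧ z = p) := by
    intro p q r h x y z h'
    obtain ⟨h1, h2, h3⟩ := hB _ _ _ h
    obtain ⟨h4, h5, h6⟩ := hB _ _ _ h'
    have hW : ∀ x, x = p ∨ x = q ∨ x = r := by
      intro x
      have := hV x; have := hV p; have := hV q; have := hV r
      grind
    have := hr p q r h
    have := hl p q r h
    rcases hW x with rfl | rfl | rfl <;> rcases hW y with rfl | rfl | rfl <;>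
      rcases hW z with rfl | rfl | rfl <;> simp_all
  by_cases h2 : ∃ p q r, B p q r ∧ B r q p
  · obtain ⟨p, q, r, h, h'⟩ := h2
    obtain ⟨e1, e2, e3⟩ := hB _ _ _ h
    refine ⟨2, p, q, r, e1, e2, e3, fun x y z => ?_⟩
    simp only [trip3, Set.mem_insert_iff, Set.mem_singleton_iff, Prod.mk.injEq]
    have := key p q r h x y z
    have := key r q p h' x y z
    grind
  by_cases h4 : ∃ p q r, B p q r ∧ B q r p ∧ B r p q
  · obtain ⟨p, q, r, h, h', h''⟩ := h4
    obtain ⟨e1, e2, e3⟩ := hB _ _ _ h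
    refine ⟨4, p, q, r, e1, e2, e3, fun x y z => ?_⟩
    simp only [trip3, Set.mem_insert_iff, Set.mem_singleton_iff, Prod.mk.injEq]
    have := key p q r h x y z
    grind
  by_cases h3 : ∃ p q r, B p q r ∧ B q r p
  · obtain ⟨p, q, r, h, h'⟩ := h3
    obtain ⟨e1, e2, e3⟩ := hB _ _ _ h
    refine ⟨3, p, q, r, e1, e2, e3, fun x y z => ?_⟩
    simp only [trip3, Set.mem_insert_iff, Set.mem_singleton_iff, Prod.mk.injEq]
    have := key p q r h x y z
    grind
  by_cases h1 : ∃ p q r, B p q r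
  · obtain ⟨p, q, r, h⟩ := h1
    obtain ⟨e1, e2, e3⟩ := hB _ _ _ h
    refine ⟨1, p, q, r, e1, e2, e3, fun x y z => ?_⟩
    simp only [trip3, Set.mem_singleton_iff, Prod.mk.injEq]
    have := key p q r h x y z
    grind
  · refine ⟨0, a, b, c, hab, hbc, hac, fun x y z => ?_⟩
    simp only [trip3, Set.mem_empty_iff_false, iff_false]
    exact fun h => h1 ⟨x, y, z, h⟩

/-- Four properties of a set `trip3 a b c i`, invariant under relabelling, which determine `i`. -/
theorem trip3_invariants {V : Type*} {a b c : V} (hab : a ≠ b) (hbc : b ≠ c) (hac : a ≠ c)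
    (i : Fin 5) :
    ((∃ x y z, (x, y, z) ∈ trip3 a b c i) ↔ i ≠ 0) ∧
    ((∃ x y z, (x, y, z) ∈ trip3 a b c i ∧ (z, y, x) ∈ trip3 a b c i) ↔ i = 2) ∧
    ((∃ x y z, (x, y, z) ∈ trip3 a b c i ∧ (y, z, x) ∈ trip3 a b c i) ↔ i = 3 ∨ i = 4) ∧
    ((∃ x y z, (x, y, z) ∈ trip3 a b c i ∧ (y, z, x) ∈ trip3 a b c i ∧
      (z, x, y) ∈ trip3 a b c i) ↔ i = 4) := by
  fin_cases i <;>
    simp only [trip3, Set.mem_insert_iff, Set.mem_singleton_iff, Set.mem_empty_iff_false,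
      Prod.mk.injEq] <;> refine ⟨?_, ?_, ?_, ?_⟩ <;> simp <;>
    first | exact ⟨a, b, c, by simp⟩ | grind

theorem trip3_index_unique {V : Type*} {a b c : V} (hab : a ≠ b) (hbc : b ≠ c) (hac : a ≠ c)
    {i j : Fin 5} (f : V ≃ V)
    (h : ∀ x y z, (x, y, z) ∈ trip3 a b c i ↔ (f x, f y, f z) ∈ trip3 a b c j) : i = j := by
  obtain ⟨i1, i2, i3, i4⟩ := trip3_invariants hab hbc hac i
  obtain ⟨j1, j2, j3, j4⟩ := trip3_invariants hab hbc hac j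
  simp only [h] at i1 i2 i3 i4
  rw [f.surjective.exists₃] at j1 j2 j3 j4
  have e1 := i1.symm.trans j1
  have e2 := i2.symm.trans j2
  have e3 := i3.symm.trans j3
  have e4 := i4.symm.trans j4
  clear * - e1 e2 e3 e4
  revert i j
  decide

theorem exists_equiv_map_triple {V : Type*} {a b c p q r : V}
    (hab : a ≠ b) (hbc : b ≠ c) (hac : a ≠ c) (hV : ∀ x : V, x = a ∨ x = b ∨ x = c)
    (hpq : p ≠ q) (hqr : q ≠ r) (hpr : p ≠ r) :
    ∃ f : V ≃ V, f p = a ∧ f q = b ∧ f r = c := by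
  classical
  have hinj : Function.Injective ![p, q, r] := by
    intro i j; fin_cases i <;> fin_cases j <;> simp_all [eq_comm]
  have hinj' : Function.Injective ![a, b, c] := by
    intro i j; fin_cases i <;> fin_cases j <;> simp_all [eq_comm]
  have hsurj' : Function.Surjective ![a, b, c] := fun x => by
    rcases hV x with rfl | rfl | rfl
    exacts [⟨0, rfl⟩, ⟨1, rfl⟩, ⟨2, rfl⟩]
  let e := Equiv.ofBijective _ ⟨hinj', hsurj'⟩
  have hsurj : Function.Surjective ![p, q, r] := hinj.surjective_of_finite e
  let g := Equiv.ofBijective _ ⟨hinj, hsurj⟩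
  have hg : ∀ i, (g.symm.trans e) (![p, q, r] i) = ![a, b, c] i := fun i =>
    congrArg e (g.symm_apply_apply i)
  exact ⟨g.symm.trans e, hg 0, hg 1, hg 2⟩

/-- the betweenness of any quasi-metric space on a three-element set
`{a, b, c}` is isomorphic, via a bijection of `V`, to exactly one of the five sets
`∅`, `{(a,b,c)}`, `{(a,b,c),(c,b,a)}`, `{(a,b,c),(b,c,a)}` and
`{(a,b,c),(b,c,a),(c,a,b)}`. -/
theorem stmt_11 (V : Type) (d : V → V → ℝ) (hd : IsQuasiMetric d)
    (a b c : V) (hab : a ≠ b) (hbc : b ≠ c) (hac : a ≠ c)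
    (hV : ∀ x : V, x = a ∨ x = b ∨ x = c) :
    ∃! i : Fin 5, ∃ f : V ≃ V,
      ∀ x y z : V, BtwQM d x y z ↔ (f x, f y, f z) ∈ trip3 a b c i := by
  obtain ⟨i, p, q, r, hpq, hqr, hpr, h⟩ := exists_eq_trip3 (B := BtwQM d) hab hbc hac hV
    (fun _ _ _ h => ⟨h.1, h.2.1, h.2.2.1⟩) (fun _ _ _ => BtwQM.not_swap_right hd)
    (fun _ _ _ => BtwQM.not_swap_left hd)
  obtain ⟨f, hp, hq, hr⟩ := exists_equiv_map_triple hab hbc hac hV hpq hqr hpr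
  have hf : ∀ x y z, BtwQM d x y z ↔ (f x, f y, f z) ∈ trip3 a b c i := fun x y z => by
    rw [h, ← mem_trip3_map_iff f, hp, hq, hr]
  refine ⟨i, ⟨f, hf⟩, fun j ⟨g, hg⟩ => ?_⟩
  refine trip3_index_unique hab hbc hac (g.symm.trans f) fun x y z => ?_
  simpa using (hg (g.symm x) (g.symm y) (g.symm z)).symm.trans (hf _ _ _)
end
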